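/- Let X be either c₀(ℕ,K) with its norm topology or K^ℕ with the Tychonoff product topology, let U be an open subset of X, and let {K_j : j ∈ ℕ} be a sequence of closed subsets of X such that K_j ⊆ U and K_j is infinitely deficient for each j. Then there exists a homeomorphism g of X \ ⋃_{j=1}^∞ K_j onto X such that g restricted to X \ U is the identity. -/

import Mathlib

open scoped ZeroAtInfty

/-- A subset `E` of `K^ℕ` is infinitely deficient if there is an infinite set `β ⊆ ℕ`
such that the `j`-th coordinate projection maps `E` to a single point for every `j ∈ β`. -/
def InfinitelyDeficientPi {K : Type*} [NontriviallyNormedField K] (E : Set (ℕ → K)) : Prop :=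
  ∃ β : Set ℕ, β.Infinite ∧ ∀ j ∈ β, ∃ c : K, ∀ x ∈ E, x j = c

/-- A subset `E` of `c₀(ℕ, K)` is infinitely deficient if there is an infinite set
`β ⊆ ℕ` such that the `j`-th coordinate projection maps `E` to a single point for every
`j ∈ β`. -/
def InfinitelyDeficientC0 {K : Type*} [NontriviallyNormedField K] (E : Set C₀(ℕ, K)) : Prop :=
  ∃ β : Set ℕ, β.Infinite ∧ ∀ j ∈ β, ∃ c : K, ∀ x ∈ E, x j = c

open Topology Set TopologicalSpace

/-- A nonempty clopen set in a complete metric space with a countable clopen basis and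
no compact set with nonempty interior splits into infinitely many small clopen pieces. -/
lemma exists_clopen_partition {Y : Type*} [MetricSpace Y] [CompleteSpace Y]
    [SecondCountableTopology Y] (hb : IsTopologicalBasis {s : Set Y | IsClopen s})
    (hc : ∀ C : Set Y, IsCompact C → interior C = ∅) {C : Set Y} (hC : IsClopen C)
    (hne : C.Nonempty) {ε : ℝ} (hε : 0 < ε) :
    ∃ P : ℕ → Set Y, (∀ k, IsClopen (P k)) ∧ (∀ k, (P k).Nonempty) ∧
      Pairwise (fun a b => Disjoint (P a) (P b)) ∧ (⋃ k, P k) = C ∧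
      ∀ k, ∀ x ∈ P k, ∀ y ∈ P k, dist x y < ε := by
  have hntb : ¬ TotallyBounded C := fun h => by
    have := hc C (h.isCompact_of_isClosed hC.1)
    rw [hC.2.interior_eq] at this
    exact hne.ne_empty this
  obtain ⟨δ, hδ, hδC⟩ : ∃ δ > 0, ∀ t : Set Y, t.Finite → ¬ C ⊆ ⋃ y ∈ t, Metric.ball y δ := by
    rw [Metric.totallyBounded_iff] at hntb
    push Not at hntb
    exact hntb
  set η := min ε δ / 2 with hη
  have hη0 : 0 < η := by positivity
  have hηε : 2 * η ≤ ε := by rw [hη]; linarith [min_le_left ε δ]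
  have hηδ : 2 * η ≤ δ := by rw [hη]; linarith [min_le_right ε δ]
  have hx : ∀ x : Y, ∃ V : Set Y, IsClopen V ∧ x ∈ V ∧ V ⊆ Metric.ball x η := fun x => by
    obtain ⟨V, hV, hxV, hVs⟩ := hb.mem_nhds_iff.1 (Metric.ball_mem_nhds x hη0)
    exact ⟨V, hV, hxV, hVs⟩
  choose V hVc hxV hVs using hx
  obtain ⟨t, htc, htU⟩ := TopologicalSpace.countable_cover_nhds
    (fun x => (hVc x).2.mem_nhds (hxV x))
  have htne : t.Nonempty := by
    by_contra h
    rw [not_nonempty_iff_eq_empty] at h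
    obtain ⟨x, -⟩ := hne
    have : x ∈ ⋃ x ∈ t, V x := by rw [htU]; trivial
    simp [h] at this
  obtain ⟨u, rfl⟩ := htc.exists_eq_range htne
  let W : ℕ → Set Y := fun n => V (u n) ∩ C
  let D : ℕ → Set Y := disjointed W
  have hDc : ∀ n, IsClopen (D n) := fun n =>
    disjointedRec (p := IsClopen) (fun _ _ hs => hs.diff ((hVc _).inter hC)) ((hVc (u n)).inter hC)
  have hDU : ⋃ n, D n = C := by
    rw [iUnion_disjointed, ← iUnion_inter]
    rw [biUnion_range] at htU
    rw [htU, univ_inter]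
  have hDsmall : ∀ n, ∀ x ∈ D n, ∀ y ∈ D n, dist x y < 2 * η := fun n x hx y hy => by
    have h1 := Metric.mem_ball.1 (hVs _ (disjointed_subset W n hx).1)
    have h2 := Metric.mem_ball.1 (hVs _ (disjointed_subset W n hy).1)
    linarith [dist_triangle_right x y (u n)]
  have hinf : {n | (D n).Nonempty}.Infinite := fun hfin => by
    have : Nonempty Y := ⟨hne.some⟩
    choose! z hz using fun n (hn : n ∈ {n | (D n).Nonempty}) => hn
    refine hδC _ (hfin.image z) fun x hx => ?_
    rw [← hDU] at hx
    obtain ⟨n, hn⟩ := mem_iUnion.1 hx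
    rw [biUnion_image]
    exact mem_biUnion (show n ∈ {n | (D n).Nonempty} from ⟨x, hn⟩)
      ((hDsmall n x hn _ (hz n ⟨x, hn⟩)).trans_le hηδ)
  let e := Nat.nth fun n => (D n).Nonempty
  refine ⟨fun k => D (e k), fun k => hDc _, fun k => Nat.nth_mem_of_infinite hinf k,
    fun a b hab => disjoint_disjointed W ((Nat.nth_injective hinf).ne hab), ?_,
    fun k x hx y hy => (hDsmall _ x hx y hy).trans_le hηε⟩
  refine subset_antisymm (iUnion_subset fun k => hDU ▸ subset_iUnion D (e k)) fun x hx => ?_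
  rw [← hDU] at hx
  obtain ⟨n, hn⟩ := mem_iUnion.1 hx
  obtain ⟨k, rfl⟩ : n ∈ range e := by
    rw [Nat.range_nth_of_infinite hinf]
    exact ⟨x, hn⟩
  exact mem_iUnion.2 ⟨k, hn⟩

/-- **Alexandrov-Urysohn**: a nonempty zero-dimensional Polish space in which compact sets have
empty interior is homeomorphic to the Baire space. -/
theorem nonempty_homeomorph_nat_nat {Y : Type*} [TopologicalSpace Y] [PolishSpace Y] [Nonempty Y]
    (hb : IsTopologicalBasis {s : Set Y | IsClopen s})
    (hc : ∀ C : Set Y, IsCompact C → interior C = ∅) : Nonempty (Y ≃ₜ (ℕ → ℕ)) := by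
  let := upgradeIsCompletelyMetrizable Y
  choose! P hPc hPne hPd hPU hPdiam using
    fun (C : Set Y) (hC : IsClopen C ∧ C.Nonempty) (n : ℕ) =>
      exists_clopen_partition hb hc hC.1 hC.2 (pow_pos (one_half_pos (α := ℝ)) n)
  let A : List ℕ → Set Y := fun l => l.rec univ fun k l S => P S l.length k
  have hA : ∀ l, IsClopen (A l) ∧ (A l).Nonempty := fun l => by
    induction l with
    | nil => exact ⟨isClopen_univ, univ_nonempty⟩
    | cons k l ih => exact ⟨hPc _ ih _ _, hPne _ ih _ _⟩
  have hAU : ∀ l, ⋃ k, A (k :: l) = A l := fun l => hPU _ (hA l) _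
  have hanti : CantorScheme.Antitone A := fun l k => hAU l ▸ subset_iUnion (fun k => A (k :: l)) k
  have hdisj : CantorScheme.Disjoint A := fun l => hPd _ (hA l) _
  have hdiam : CantorScheme.VanishingDiam A := fun x => by
    rw [ENNReal.tendsto_atTop_zero]
    intro ε hε
    obtain ⟨r, hr0, hrε⟩ : ∃ r : ℝ, 0 < r ∧ ENNReal.ofReal r ≤ ε := by
      obtain ⟨r, hr, hrε⟩ := ENNReal.lt_iff_exists_nnreal_btwn.1 hε
      exact ⟨r, by exact_mod_cast hr, by simpa using hrε.le⟩
    obtain ⟨N, hN⟩ := exists_pow_lt_of_lt_one hr0 (one_half_lt_one (α := ℝ))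
    refine ⟨N + 1, fun n hn => Metric.ediam_le fun y hy z hz => ?_⟩
    obtain ⟨m, rfl⟩ : ∃ m, n = m + 1 := ⟨n - 1, by omega⟩
    rw [edist_dist]
    refine le_trans (ENNReal.ofReal_le_ofReal ?_) hrε
    rw [PiNat.res_succ] at hy hz
    have := hPdiam _ (hA (PiNat.res x m)) _ _ y hy z hz
    rw [PiNat.res_length] at this
    exact (this.le.trans (pow_le_pow_of_le_one (by norm_num) (by norm_num) (by omega))).trans hN.le
  have hdom := CantorScheme.ClosureAntitone.map_of_vanishingDiam hdiam
    (hanti.closureAntitone fun l => (hA l).1.1) fun l => (hA l).2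
  have hdom' : ∀ x, x ∈ (CantorScheme.inducedMap A).1 := fun x => hdom ▸ mem_univ x
  let f : (ℕ → ℕ) → Y := fun x => (CantorScheme.inducedMap A).2 ⟨x, hdom' x⟩
  have hfmem : ∀ x n, f x ∈ A (PiNat.res x n) := fun x n => CantorScheme.map_mem _ n
  have hfc : Continuous f := hdiam.map_continuous.comp (by fun_prop)
  have hfi : Function.Injective f := fun x y h =>
    congrArg Subtype.val (CantorScheme.Disjoint.map_injective hdisj h)
  have hres : ∀ x y n, f x ∈ A (PiNat.res y n) → PiNat.res x n = PiNat.res y n := by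
    intro x y n
    induction n with
    | zero => simp
    | succ n ih =>
      intro h
      rw [PiNat.res_succ] at h
      have h' := ih (hanti _ _ h)
      have h2 := hfmem x (n + 1)
      rw [PiNat.res_succ, h'] at h2
      rw [PiNat.res_succ, PiNat.res_succ, h']
      by_contra hne
      exact disjoint_left.1 (hdisj (PiNat.res y n) fun h => hne (by rw [h])) h2 h
  have hfs : Function.Surjective f := fun y => by
    have step : ∀ l, y ∈ A l → ∃ k, y ∈ A (k :: l) := fun l hl => by
      rwa [← hAU, mem_iUnion] at hl
    choose! k hk using step
    let L : ℕ → List ℕ := fun n => n.rec [] fun _ l => k l :: l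
    have hL : ∀ n, y ∈ A (L n) := fun n => by
      induction n with
      | zero => trivial
      | succ n ih => exact hk _ ih
    have hLres : ∀ n, PiNat.res (fun n => k (L n)) n = L n := fun n => by
      induction n with
      | zero => rfl
      | succ n ih => rw [PiNat.res_succ, ih]
    refine ⟨fun n => k (L n), eq_of_forall_dist_le fun ε hε => ?_⟩
    obtain ⟨n, hn⟩ := hdiam.dist_lt ε hε fun n => k (L n)
    exact (hn _ (hfmem _ n) _ (hLres n ▸ hL n)).le
  have hfo : IsOpenMap f := by
    refine (PiNat.isTopologicalBasis_cylinders fun _ => ℕ).isOpenMap_iff.2 ?_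
    rintro _ ⟨x, n, rfl⟩
    convert (hA (PiNat.res x n)).1.2
    rw [PiNat.cylinder_eq_res]
    ext y
    constructor
    · rintro ⟨z, hz, rfl⟩
      exact (show PiNat.res z n = PiNat.res x n from hz) ▸ hfmem z n
    · intro hy
      obtain ⟨z, rfl⟩ := hfs y
      exact ⟨z, hres z x n hy, rfl⟩
  exact ⟨((Equiv.ofBijective f ⟨hfi, hfs⟩).toHomeomorphOfContinuousOpen hfc hfo).symm⟩

/-- A countable intersection of open subsets of a Polish space is Polish. -/
lemma polishSpace_iInter_isOpen {X : Type*} [TopologicalSpace X] [PolishSpace X] {W : ℕ → Set X}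
    (hW : ∀ n, IsOpen (W n)) : PolishSpace ↥(⋂ n, W n) := by
  have := fun n => (hW n).polishSpace
  let φ : ↥(⋂ n, W n) → ∀ n, W n := fun x n => ⟨x, mem_iInter.1 x.2 n⟩
  have hφ : Continuous φ := by fun_prop
  have hemb : IsEmbedding φ := by
    refine .of_comp hφ (g := fun w => (w 0 : X)) (by fun_prop) .subtypeVal
  refine IsClosedEmbedding.polishSpace (f := φ) ⟨hemb, ?_⟩
  have : range φ = ⋂ n, {w : ∀ n, W n | (w n : X) = w 0} := by
    ext w
    simp only [mem_range, mem_iInter, mem_ofPred]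
    constructor
    · rintro ⟨x, rfl⟩ n
      rfl
    · intro h
      refine ⟨⟨w 0, mem_iInter.2 fun n => h n ▸ (w n).2⟩, funext fun n => Subtype.ext (h n).symm⟩
  rw [this]
  exact isClosed_iInter fun n => isClosed_eq (by fun_prop) (by fun_prop)

lemma isTopologicalBasis_isClopen_subtype {X : Type*} [TopologicalSpace X]
    (hb : IsTopologicalBasis {s : Set X | IsClopen s}) (S : Set X) :
    IsTopologicalBasis {s : Set S | IsClopen s} := by
  refine isTopologicalBasis_of_isOpen_of_nhds (fun s hs => hs.2) fun x s hx hs => ?_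
  obtain ⟨t, ht, rfl⟩ := isOpen_induced_iff.1 hs
  obtain ⟨V, hV, hxV, hVt⟩ := hb.mem_nhds_iff.1 (ht.mem_nhds hx)
  exact ⟨_, IsClopen.preimage hV continuous_subtype_val, hxV, preimage_mono hVt⟩

/-- In a zero-dimensional Polish space whose compact sets have empty interior, removing
countably many closed nowhere dense sets from a nonempty open set leaves a copy of the Baire
space. -/
theorem nonempty_homeomorph_diff_iUnion {X : Type*} [TopologicalSpace X] [PolishSpace X]
    (hb : IsTopologicalBasis {s : Set X | IsClopen s})
    (hc : ∀ C : Set X, IsCompact C → interior C = ∅) {F : ℕ → Set X} (hF : ∀ n, IsClosed (F n))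
    (hF' : ∀ n, interior (F n) = ∅) {C : Set X} (hC : IsOpen C) (hne : C.Nonempty) :
    Nonempty (↥(C \ ⋃ n, F n) ≃ₜ (ℕ → ℕ)) := by
  have hdense : Dense (⋃ n, F n)ᶜ := by
    let := upgradeIsCompletelyMetrizable X
    rw [compl_iUnion]
    exact dense_iInter_of_isOpen (fun n => (hF n).isOpen_compl) fun n =>
      interior_eq_empty_iff_dense_compl.1 (hF' n)
  have : PolishSpace ↥(C \ ⋃ n, F n) := by
    rw [sdiff_iUnion]
    exact polishSpace_iInter_isOpen fun n => hC.sdiff (hF n)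
  have : Nonempty ↥(C \ ⋃ n, F n) := (hdense.inter_open_nonempty C hC hne).to_subtype
  refine nonempty_homeomorph_nat_nat (isTopologicalBasis_isClopen_subtype hb _) fun D hD => ?_
  by_contra h
  obtain ⟨x, hx⟩ := nonempty_iff_ne_empty.2 h
  obtain ⟨t, ht, hts⟩ := isOpen_induced_iff.1 (isOpen_interior (s := D))
  have hcomp := hD.image continuous_subtype_val
  have hsub : t ∩ C ⊆ Subtype.val '' D := by
    refine ((ht.inter hC).subset_interior_iff.2 subset_rfl |>.trans interior_subset).trans
      ((hdense.open_subset_closure_inter (ht.inter hC)).trans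
      (closure_minimal ?_ hcomp.isClosed))
    rintro y ⟨⟨hyt, hyC⟩, hyF⟩
    refine ⟨⟨y, hyC, hyF⟩, interior_subset (s := D) ?_, rfl⟩
    rw [← hts]
    exact hyt
  rw [← hts] at hx
  have : (x : X) ∈ interior (Subtype.val '' D) :=
    mem_interior.2 ⟨_, hsub, ht.inter hC, hx, x.2.1⟩
  rw [hc _ hcomp] at this
  exact this

/-- Homeomorphic subsets are related by globally defined functions. -/
lemma exists_invOn_of_homeomorph {X : Type*} [TopologicalSpace X] [Nonempty X] {S T : Set X}
    (e : S ≃ₜ T) : ∃ f f' : X → X, MapsTo f S T ∧ MapsTo f' T S ∧ ContinuousOn f S ∧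
      ContinuousOn f' T ∧ LeftInvOn f' f S ∧ LeftInvOn f f' T := by
  classical
  obtain ⟨x₀⟩ := ‹Nonempty X›
  have hf : ∀ x (hx : x ∈ S), (if h : x ∈ S then (e ⟨x, h⟩ : X) else x₀) = e ⟨x, hx⟩ :=
    fun x hx => dif_pos hx
  have hf' : ∀ x (hx : x ∈ T), (if h : x ∈ T then (e.symm ⟨x, h⟩ : X) else x₀) = e.symm ⟨x, hx⟩ :=
    fun x hx => dif_pos hx
  refine ⟨fun x => if h : x ∈ S then e ⟨x, h⟩ else x₀,
    fun x => if h : x ∈ T then e.symm ⟨x, h⟩ else x₀, fun x hx => ?_, fun x hx => ?_, ?_, ?_,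
    fun x hx => ?_, fun x hx => ?_⟩
  · simp only [hf x hx, Subtype.coe_prop]
  · simp only [hf' x hx, Subtype.coe_prop]
  · rw [continuousOn_iff_continuous_domRestrict]
    convert continuous_subtype_val.comp e.continuous using 1
    exact funext fun x => hf x x.2
  · rw [continuousOn_iff_continuous_domRestrict]
    convert continuous_subtype_val.comp e.symm.continuous using 1
    exact funext fun x => hf' x x.2
  · simp only [hf x hx, Subtype.coe_prop, ↓reduceDIte, Subtype.coe_eta,
      Homeomorph.symm_apply_apply]
  · simp only [hf' x hx, Subtype.coe_prop, ↓reduceDIte, Subtype.coe_eta,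
      Homeomorph.apply_symm_apply]

/-- The cylinders of the Baire space that are maximal in an open set `U`: a function `c` assigning
to each point of `U` a clopen neighbourhood in `U`, such that these neighbourhoods partition `U` and
shrink near the complement of `U`. -/
lemma exists_maximal_cylinders {U : Set (ℕ → ℕ)} (hU : IsOpen U) :
    ∃ c : (ℕ → ℕ) → Set (ℕ → ℕ), (∀ x ∈ U, IsOpen (c x) ∧ x ∈ c x ∧ c x ⊆ U) ∧
      (∀ x ∈ U, ∀ y ∈ c x, c y = c x) ∧
      ∀ x ∉ U, ∀ n, ∀ y ∈ PiNat.cylinder x n, y ∈ U → c y ⊆ PiNat.cylinder x n := by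
  classical
  have hex : ∀ x ∈ U, ∃ n, PiNat.cylinder x n ⊆ U := fun x hx => by
    obtain ⟨_, ⟨y, n, rfl⟩, hxV, hVU⟩ :=
      (PiNat.isTopologicalBasis_cylinders fun _ => ℕ).mem_nhds_iff.1 (hU.mem_nhds hx)
    exact ⟨n, (PiNat.mem_cylinder_iff_eq.1 hxV).subset.trans hVU⟩
  choose! N hN hNmin using fun x (hx : x ∈ U) =>
    (⟨Nat.find (hex x hx), Nat.find_spec (hex x hx), fun m hm => Nat.find_min' (hex x hx) hm⟩ :
      ∃ n, PiNat.cylinder x n ⊆ U ∧ ∀ m, PiNat.cylinder x m ⊆ U → n ≤ m)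
  refine ⟨fun x => PiNat.cylinder x (N x), fun x hx => ⟨PiNat.isOpen_cylinder _ x _,
    PiNat.self_mem_cylinder x _, hN x hx⟩, fun x hx y hy => ?_, fun x hx n y hy hyU => ?_⟩
  · have hyU := hN x hx hy
    have hxy := PiNat.mem_cylinder_iff_eq.1 hy
    have h1 : N y ≤ N x := hNmin y hyU _ (hxy ▸ hN x hx)
    have hyx : PiNat.cylinder y (N y) = PiNat.cylinder x (N y) :=
      PiNat.mem_cylinder_iff_eq.1 (PiNat.cylinder_anti x h1 hy)
    have h2 : N x ≤ N y := hNmin x hx _ (hyx ▸ hN y hyU)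
    simpa only [le_antisymm h1 h2] using hyx
  · have hxy := PiNat.mem_cylinder_iff_eq.1 hy
    rw [← hxy]
    refine PiNat.cylinder_anti y (le_of_not_ge fun h => hx (hN y hyU ?_))
    exact PiNat.cylinder_anti y h (hxy ▸ PiNat.self_mem_cylinder x n)

/-- A function acting on each piece of a partition of `U` as in `exists_maximal_cylinders`,
extended by the identity, is continuous. -/
lemma continuousOn_piecewise_of_maximal_cylinders {U M : Set (ℕ → ℕ)}
    {c : (ℕ → ℕ) → Set (ℕ → ℕ)} [DecidablePred (· ∈ U)]
    (hc : ∀ x ∈ U, IsOpen (c x) ∧ x ∈ c x ∧ c x ⊆ U) (hcc : ∀ x ∈ U, ∀ y ∈ c x, c y = c x)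
    (hcb : ∀ x ∉ U, ∀ n, ∀ y ∈ PiNat.cylinder x n, y ∈ U → c y ⊆ PiNat.cylinder x n)
    {f : Set (ℕ → ℕ) → (ℕ → ℕ) → (ℕ → ℕ)} (hf : ∀ x ∈ U, ContinuousOn (f (c x)) (c x ∩ M))
    (hf' : ∀ x ∈ U, MapsTo (f (c x)) (c x ∩ M) (c x)) :
    ContinuousOn (fun x => if x ∈ U then f (c x) x else x) M := by
  intro x hxM
  by_cases hx : x ∈ U
  · obtain ⟨hco, hxc, hcU⟩ := hc x hx
    have h := hf x hx x ⟨hxc, hxM⟩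
    rw [ContinuousWithinAt, inter_comm, nhdsWithin_inter_of_mem'
      (mem_nhdsWithin_of_mem_nhds (hco.mem_nhds hxc))] at h
    refine ContinuousWithinAt.congr_of_eventuallyEq h ?_ (if_pos hx)
    filter_upwards [mem_nhdsWithin_of_mem_nhds (hco.mem_nhds hxc)] with y hy
    rw [if_pos (hcU hy), hcc x hx y hy]
  · rw [ContinuousWithinAt, if_neg hx,
      (PiNat.isTopologicalBasis_cylinders fun _ => ℕ).nhds_hasBasis.tendsto_right_iff]
    rintro _ ⟨⟨z, n, rfl⟩, hxz⟩
    have hzx : PiNat.cylinder x n = PiNat.cylinder z n := PiNat.mem_cylinder_iff_eq.1 hxz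
    rw [← hzx]
    filter_upwards [self_mem_nhdsWithin, mem_nhdsWithin_of_mem_nhds
      ((PiNat.isOpen_cylinder _ x n).mem_nhds (PiNat.self_mem_cylinder x n))] with y hyM hy
    split_ifs with hyU
    · exact hcb x hx n y hy hyU (hf' y hyU ⟨(hc y hyU).2.1, hyM⟩)
    · exact hy

/-- In the Baire space, countably many closed nowhere dense subsets of an open set `U` can be
removed by a homeomorphism which is the identity off `U`. -/
theorem exists_homeomorph_compl_iUnion_nat_nat {U : Set (ℕ → ℕ)} (hU : IsOpen U)
    {F : ℕ → Set (ℕ → ℕ)} (hF : ∀ n, IsClosed (F n)) (hFU : ∀ n, F n ⊆ U)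
    (hF' : ∀ n, interior (F n) = ∅)
    (hb : IsTopologicalBasis {s : Set (ℕ → ℕ) | IsClopen s})
    (hcpt : ∀ C : Set (ℕ → ℕ), IsCompact C → interior C = ∅) :
    ∃ g : ↥((⋃ n, F n)ᶜ) ≃ₜ (ℕ → ℕ), ∀ x : ↥((⋃ n, F n)ᶜ), (x : ℕ → ℕ) ∉ U → g x = x := by
  classical
  obtain ⟨c, hc, hcc, hcb⟩ := exists_maximal_cylinders hU
  set M := (⋃ n, F n)ᶜ
  have hUM : Uᶜ ⊆ M := compl_subset_compl.2 (iUnion_subset hFU)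
  have hpiece : ∀ C : Set (ℕ → ℕ), IsOpen C ∧ C.Nonempty → ∃ f f' : (ℕ → ℕ) → (ℕ → ℕ),
      MapsTo f (C ∩ M) C ∧ MapsTo f' C (C ∩ M) ∧ ContinuousOn f (C ∩ M) ∧
      ContinuousOn f' C ∧ LeftInvOn f' f (C ∩ M) ∧ LeftInvOn f f' C := fun C hC => by
    obtain ⟨e₁⟩ := nonempty_homeomorph_diff_iUnion hb hcpt hF hF' hC.1 hC.2
    obtain ⟨e₂⟩ := nonempty_homeomorph_diff_iUnion hb hcpt (F := fun _ => ∅)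
      (fun _ => isClosed_empty) (fun _ => interior_empty) hC.1 hC.2
    rw [iUnion_empty, sdiff_empty] at e₂
    exact exists_invOn_of_homeomorph (e₁.trans e₂.symm)
  choose! f f' hfm hfm' hfc hfc' hff hff' using hpiece
  have hcne : ∀ x ∈ U, IsOpen (c x) ∧ (c x).Nonempty :=
    fun x hx => ⟨(hc x hx).1, x, (hc x hx).2.1⟩
  have hg := continuousOn_piecewise_of_maximal_cylinders (f := f) hc hcc hcb
    (fun x hx => hfc _ (hcne x hx)) (fun x hx => hfm _ (hcne x hx))
  have hg' := continuousOn_piecewise_of_maximal_cylinders (M := univ) (f := f') hc hcc hcb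
    (fun x hx => by simpa using hfc' _ (hcne x hx))
    (fun x hx => by simpa using (hfm' _ (hcne x hx)).mono_right inter_subset_left)
  set g := fun x => if x ∈ U then f (c x) x else x with hgdef
  set g' := fun x => if x ∈ U then f' (c x) x else x with hgdef'
  have hgM' : ∀ x, g' x ∈ M := fun x => by
    by_cases hx : x ∈ U
    · simpa only [hgdef', if_pos hx] using (hfm' _ (hcne x hx) (hc x hx).2.1).2
    · simpa only [hgdef', if_neg hx] using hUM hx
  have hleft : ∀ x ∈ M, g' (g x) = x := fun x hxM => by
    by_cases hx : x ∈ U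
    · have hxc : x ∈ c x ∩ M := ⟨(hc x hx).2.1, hxM⟩
      have hgc := hfm _ (hcne x hx) hxc
      simp only [hgdef, hgdef', if_pos hx, if_pos ((hc x hx).2.2 hgc), hcc x hx _ hgc]
      exact hff _ (hcne x hx) hxc
    · simp only [hgdef, hgdef', if_neg hx]
  have hright : ∀ x, g (g' x) = x := fun x => by
    by_cases hx : x ∈ U
    · have hgc := hfm' _ (hcne x hx) (hc x hx).2.1
      simp only [hgdef, hgdef', if_pos hx, if_pos ((hc x hx).2.2 hgc.1), hcc x hx _ hgc.1]
      exact hff' _ (hcne x hx) (hc x hx).2.1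
    · simp only [hgdef, hgdef', if_neg hx]
  refine ⟨{ toFun := fun x => g x
            invFun := fun x => ⟨g' x, hgM' x⟩
            left_inv := fun x => Subtype.ext (hleft x x.2)
            right_inv := hright
            continuous_toFun := continuousOn_iff_continuous_domRestrict.1 hg
            continuous_invFun := (continuousOn_univ.1 hg').subtype_mk _ },
    fun x hx => if_neg hx⟩

/-- In a zero-dimensional Polish space whose compact sets have empty interior, countably many
closed nowhere dense subsets of an open set `U` can be removed by a homeomorphism which is the
identity off `U`. -/
theorem exists_homeomorph_compl_iUnion {X : Type*} [TopologicalSpace X] [PolishSpace X]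
    (hb : IsTopologicalBasis {s : Set X | IsClopen s})
    (hc : ∀ C : Set X, IsCompact C → interior C = ∅) {U : Set X} (hU : IsOpen U)
    {F : ℕ → Set X} (hF : ∀ n, IsClosed (F n)) (hFU : ∀ n, F n ⊆ U)
    (hF' : ∀ n, interior (F n) = ∅) :
    ∃ g : ↥((⋃ n, F n)ᶜ) ≃ₜ X, ∀ x : ↥((⋃ n, F n)ᶜ), (x : X) ∉ U → g x = x := by
  rcases isEmpty_or_nonempty X with hX | hX
  · have : IsEmpty ↥((⋃ n, F n)ᶜ) := ⟨fun x => hX.elim x⟩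
    exact ⟨Homeomorph.empty, fun x => hX.elim x⟩
  obtain ⟨e⟩ := nonempty_homeomorph_nat_nat hb hc
  have hb' : IsTopologicalBasis {s : Set (ℕ → ℕ) | IsClopen s} := by
    refine isTopologicalBasis_of_isOpen_of_nhds (fun s hs => hs.2) fun x s hx hs => ?_
    obtain ⟨V, hV, hxV, hVs⟩ := hb.mem_nhds_iff.1
      ((hs.preimage e.continuous).mem_nhds (show e.symm x ∈ e ⁻¹' s by simpa using hx))
    exact ⟨e.symm ⁻¹' V, IsClopen.preimage hV e.symm.continuous, hxV, fun y hy => by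
      simpa using hVs hy⟩
  obtain ⟨g, hg⟩ := exists_homeomorph_compl_iUnion_nat_nat (U := e.symm ⁻¹' U)
    (F := fun n => e.symm ⁻¹' F n) (hU.preimage e.symm.continuous)
    (fun n => (hF n).preimage e.symm.continuous) (fun n => preimage_mono (hFU n))
    (fun n => by rw [← e.symm.preimage_interior, hF' n, preimage_empty]) hb'
    (fun C hC => by
      have := hc _ (hC.image e.symm.continuous)
      rwa [← e.symm.image_interior, image_eq_empty] at this)
  have hmem : ∀ x, x ∈ (⋃ n, F n)ᶜ ↔ e x ∈ (⋃ n, e.symm ⁻¹' F n)ᶜ := fun x => by simp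
  refine ⟨(e.subtype hmem).trans (g.trans e.symm), fun x hx => ?_⟩
  have := hg (e.subtype hmem x) (by simpa using hx)
  simp only [Homeomorph.trans_apply, this]
  simp

lemma isTopologicalBasis_isClopen_of_isUltrametricDist (X : Type*) [PseudoMetricSpace X]
    [IsUltrametricDist X] : IsTopologicalBasis {s : Set X | IsClopen s} := by
  refine isTopologicalBasis_of_isOpen_of_nhds (fun s hs => hs.2) fun x s hx hs => ?_
  obtain ⟨ε, hε, h⟩ := Metric.isOpen_iff.1 hs x hx
  exact ⟨_, IsUltrametricDist.isClopen_ball x ε, Metric.mem_ball_self hε, h⟩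

lemma isTopologicalBasis_isClopen_pi {ι : Type*} {X : ι → Type*} [∀ i, TopologicalSpace (X i)]
    (hb : ∀ i, IsTopologicalBasis {s : Set (X i) | IsClopen s}) :
    IsTopologicalBasis {s : Set (∀ i, X i) | IsClopen s} := by
  refine isTopologicalBasis_of_isOpen_of_nhds (fun s hs => hs.2) fun x s hx hs => ?_
  obtain ⟨_, ⟨V, I, hV, rfl⟩, hxV, hVs⟩ :=
    (isTopologicalBasis_pi hb).mem_nhds_iff.1 (hs.mem_nhds hx)
  refine ⟨_, ?_, hxV, hVs⟩
  rw [Set.pi_def]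
  exact I.finite_toSet.isClopen_biInter fun i hi => (hV i hi).preimage (continuous_apply i)

/-- Compact subsets of an infinite-dimensional topological vector space have empty interior. -/
lemma interior_eq_empty_of_isCompact (K : Type*) {E : Type*} [NontriviallyNormedField K]
    [CompleteSpace K] [AddCommGroup E] [Module K E] [TopologicalSpace E] [IsTopologicalAddGroup E]
    [ContinuousSMul K E] [T2Space E] (hinf : ¬ FiniteDimensional K E) {C : Set E}
    (hC : IsCompact C) : interior C = ∅ := by
  by_contra h
  obtain ⟨x, hx⟩ := nonempty_iff_ne_empty.2 h
  have := hC.locallyCompactSpace_of_mem_nhds_of_addGroup (mem_interior_iff_mem_nhds.1 hx)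
  exact hinf (.of_locallyCompactSpace K)

/-- A set on which a nonzero continuous functional is constant has empty interior. -/
lemma interior_eq_empty_of_functional_const {K E : Type*} [NontriviallyNormedField K]
    [AddCommGroup E] [Module K E] [TopologicalSpace E] [IsTopologicalAddGroup E]
    [ContinuousSMul K E] (f : StrongDual K E) (hf : f ≠ 0) {S : Set E} {a : K}
    (hS : ∀ x ∈ S, f x = a) : interior S = ∅ := by
  by_contra h
  obtain ⟨x, hx⟩ := nonempty_iff_ne_empty.2 h
  have ho := f.isOpenMap_of_ne_zero hf _ (isOpen_interior (s := S))
  have : f '' interior S = {a} := by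
    refine subset_antisymm ?_ ?_
    · rintro _ ⟨y, hy, rfl⟩
      exact hS y (interior_subset hy)
    · rintro _ rfl
      exact ⟨x, hx, hS x (interior_subset hx)⟩
  rw [this] at ho
  exact not_isOpen_singleton a ho

namespace ZeroAtInftyContinuousMap

/-- Evaluation at a point as a continuous linear functional. -/
noncomputable def evalCLM (K : Type*) {α : Type*} [TopologicalSpace α]
    [NontriviallyNormedField K] (a : α) : StrongDual K C₀(α, K) :=
  LinearMap.mkContinuous
    { toFun := fun f => f a
      map_add' := fun _ _ => rfl
      map_smul' := fun _ _ => rfl } 1 fun f => by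
    simpa using (f.toBCF.norm_coe_le_norm a)

@[simp]
lemma evalCLM_apply {K α : Type*} [TopologicalSpace α] [NontriviallyNormedField K] (a : α)
    (f : C₀(α, K)) : evalCLM K a f = f a := rfl

instance isUltrametricDist {α β : Type*} [TopologicalSpace α] [MetricSpace β] [Zero β]
    [IsUltrametricDist β] : IsUltrametricDist C₀(α, β) where
  dist_triangle_max f g h := by
    have key : ∀ f g : C₀(α, β), ∀ x, dist (f x) (g x) ≤ dist f g := fun f g x =>
      BoundedContinuousFunction.dist_coe_le_dist (f := f.toBCF) (g := g.toBCF) x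
    rw [← dist_toBCF_eq_dist,
      BoundedContinuousFunction.dist_le (le_max_of_le_left dist_nonneg)]
    exact fun x => (dist_triangle_max (f x) (g x) (h x)).trans (max_le_max (key f g x) (key g h x))

/-- The finitely supported sequence with a single nonzero value. -/
def single {K : Type*} [NontriviallyNormedField K] (n : ℕ) : C₀(ℕ, K) where
  toFun := Pi.single n 1
  continuous_toFun := continuous_of_discreteTopology
  zero_at_infty' := by
    rw [Filter.cocompact_eq_cofinite, Nat.cofinite_eq_atTop]
    refine tendsto_const_nhds.congr' ?_
    filter_upwards [Filter.eventually_gt_atTop n] with m hm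
    rw [Pi.single_eq_of_ne hm.ne']

lemma single_apply {K : Type*} [NontriviallyNormedField K] (n m : ℕ) :
    (single n : C₀(ℕ, K)) m = if m = n then 1 else 0 := Pi.single_apply n 1 m

lemma linearIndependent_single (K : Type*) [NontriviallyNormedField K] :
    LinearIndependent K (single : ℕ → C₀(ℕ, K)) := by
  let φ : C₀(ℕ, K) →ₗ[K] ℕ → K := LinearMap.pi fun n => (evalCLM K n).toLinearMap
  refine LinearIndependent.of_comp φ ?_
  exact Pi.linearIndependent_single_one ℕ K

instance separableSpace (K : Type*) [NontriviallyNormedField K] [SeparableSpace K] :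
    SeparableSpace C₀(ℕ, K) := by
  have hs : IsSeparable (Submodule.span K (range (single : ℕ → C₀(ℕ, K))) : Set C₀(ℕ, K)) :=
    (countable_range _).isSeparable.span
  rw [← isSeparable_univ_iff]
  refine hs.closure.mono fun f _ => Metric.mem_closure_iff.2 fun ε hε => ?_
  have hf := f.zero_at_infty'
  rw [Filter.cocompact_eq_cofinite, Nat.cofinite_eq_atTop, Metric.tendsto_atTop] at hf
  obtain ⟨N, hN⟩ := hf (ε / 2) (half_pos hε)
  refine ⟨∑ n ∈ Finset.range N, f n • single n, Submodule.sum_mem _ fun n _ =>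
    Submodule.smul_mem _ _ (Submodule.subset_span ⟨n, rfl⟩), ?_⟩
  refine lt_of_le_of_lt ?_ (half_lt_self hε)
  rw [← dist_toBCF_eq_dist, BoundedContinuousFunction.dist_le (half_pos hε).le]
  intro m
  have hm : (∑ n ∈ Finset.range N, f n • single n : C₀(ℕ, K)) m = if m < N then f m else 0 := by
    rw [← evalCLM_apply m, map_sum]
    simp [single_apply]
  change dist (f m) ((∑ n ∈ Finset.range N, f n • single n : C₀(ℕ, K)) m) ≤ _
  rw [hm]
  split_ifs with h
  · simpa using (half_pos hε).le
  · exact (hN m (not_lt.1 h)).le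

end ZeroAtInftyContinuousMap

/-- Let `K` be a locally compact field with a complete
non-Archimedean multiplicative norm whose value group is nontrivial.  Let `X` be either
`c₀(ℕ, K)` with its norm topology or `K^ℕ` with the Tychonoff product topology, let `U`
be open in `X` and let `{K_j}` be closed subsets of `X` with `K_j ⊆ U`, each infinitely
deficient.  Then there is a homeomorphism `g` of `X \ ⋃_j K_j` onto `X` which is the
identity on `X \ U`. -/
theorem exists_homeomorph_complement_infinitely_deficient (K : Type*)
    [NontriviallyNormedField K] [IsUltrametricDist K] [CompleteSpace K]
    [LocallyCompactSpace K] :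
    (∀ (U : Set C₀(ℕ, K)), IsOpen U → ∀ Kj : ℕ → Set C₀(ℕ, K),
      (∀ j, IsClosed (Kj j)) → (∀ j, Kj j ⊆ U) → (∀ j, InfinitelyDeficientC0 (Kj j)) →
      ∃ g : ↥((⋃ j, Kj j)ᶜ) ≃ₜ C₀(ℕ, K),
        ∀ x : ↥((⋃ j, Kj j)ᶜ), (x : C₀(ℕ, K)) ∉ U → g x = (x : C₀(ℕ, K))) ∧
    (∀ (U : Set (ℕ → K)), IsOpen U → ∀ Kj : ℕ → Set (ℕ → K),
      (∀ j, IsClosed (Kj j)) → (∀ j, Kj j ⊆ U) → (∀ j, InfinitelyDeficientPi (Kj j)) →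
      ∃ g : ↥((⋃ j, Kj j)ᶜ) ≃ₜ (ℕ → K),
        ∀ x : ↥((⋃ j, Kj j)ᶜ), (x : ℕ → K) ∉ U → g x = (x : ℕ → K)) := by
  have := ProperSpace.of_nontriviallyNormedField_of_weaklyLocallyCompactSpace K
  constructor
  · intro U hU F hF hFU hFd
    refine exists_homeomorph_compl_iUnion (isTopologicalBasis_isClopen_of_isUltrametricDist _)
      (fun C hC => interior_eq_empty_of_isCompact K (fun _ => ?_) hC) hU hF hFU fun n => ?_
    · exact Module.Finite.not_linearIndependent_of_infinite _
        (ZeroAtInftyContinuousMap.linearIndependent_single K)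
    · obtain ⟨β, hβ, h⟩ := hFd n
      obtain ⟨j, hj⟩ := hβ.nonempty
      obtain ⟨a, ha⟩ := h j hj
      refine interior_eq_empty_of_functional_const (ZeroAtInftyContinuousMap.evalCLM K j)
        (fun h0 => ?_) ha
      simpa [ZeroAtInftyContinuousMap.single_apply] using
        DFunLike.congr_fun h0 (ZeroAtInftyContinuousMap.single j)
  · intro U hU F hF hFU hFd
    refine exists_homeomorph_compl_iUnion (isTopologicalBasis_isClopen_pi fun _ =>
        isTopologicalBasis_isClopen_of_isUltrametricDist K)
      (fun C hC => interior_eq_empty_of_isCompact K (fun _ => ?_) hC) hU hF hFU fun n => ?_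
    · exact Module.Finite.not_linearIndependent_of_infinite _
        (Pi.linearIndependent_single_one ℕ K)
    · obtain ⟨β, hβ, h⟩ := hFd n
      obtain ⟨j, hj⟩ := hβ.nonempty
      obtain ⟨a, ha⟩ := h j hj
      refine interior_eq_empty_of_functional_const (ContinuousLinearMap.proj j)
        (fun h0 => ?_) ha
      simpa using DFunLike.congr_fun h0 (Pi.single j 1)
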